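/- There exist absolute constants C and x₀ such that for every real x ≥ x₀ and every primitive quadratic Dirichlet character χ modulo q with q ≤ log x: ∏_{p ≤ x} (1 − χ(p)/p) · L(1,χ) ≤ C, where the product runs over rational primes p ≤ x. Here χ takes the real values −1, 0, 1, the product is a positive real number, and L(1,χ) is the (positive real) value at s = 1 of the Dirichlet L-function of χ. -/

import Mathlib

open NumberField Finset

/-- A weak form of Mertens' first theorem. -/
lemma sum_primesBelow_log_div_le {N : ℕ} (hN : 1 ≤ N) :
    ∑ p ∈ (N + 1).primesBelow, Real.log p / p ≤ Real.log N + Real.log 4 := by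
  have hN0 : (0 : ℝ) < N := by exact_mod_cast hN
  have hsub : (N + 1).primesBelow ⊆ Ioc 0 N := fun p hp ↦ by
    have h1 := Nat.lt_of_mem_primesBelow hp
    have h2 := (Nat.prime_of_mem_primesBelow hp).pos
    simp only [mem_Ioc]; omega
  have hfloor : ∑ p ∈ (N + 1).primesBelow, Real.log p * (N / p : ℕ) ≤ N * Real.log N := by
    calc ∑ p ∈ (N + 1).primesBelow, Real.log p * (N / p : ℕ)
        = ∑ p ∈ (N + 1).primesBelow, ArithmeticFunction.vonMangoldt p * (N / p : ℕ) :=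
          sum_congr rfl fun p hp ↦ by
            rw [ArithmeticFunction.vonMangoldt_apply_prime (Nat.prime_of_mem_primesBelow hp)]
      _ ≤ ∑ n ∈ Ioc 0 N, ArithmeticFunction.vonMangoldt n * (N / n : ℕ) :=
          sum_le_sum_of_subset_of_nonneg hsub fun n _ _ ↦
            mul_nonneg ArithmeticFunction.vonMangoldt_nonneg (Nat.cast_nonneg _)
      _ = ∑ n ∈ Ioc 0 N, Real.log n := by
          rw [← ArithmeticFunction.sum_Ioc_mul_zeta_eq_sum,
            ArithmeticFunction.vonMangoldt_mul_zeta]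
          simp
      _ ≤ ∑ n ∈ Ioc 0 N, Real.log N := sum_le_sum fun n hn ↦ by
          rw [mem_Ioc] at hn
          exact Real.log_le_log (by exact_mod_cast hn.1) (by exact_mod_cast hn.2)
      _ = N * Real.log N := by simp
  have htheta : ∑ p ∈ (N + 1).primesBelow, Real.log p ≤ Real.log 4 * N := by
    have h := Chebyshev.theta_le_log4_mul_x hN0.le
    rwa [Chebyshev.theta_eq_sum_primesLE_log] at h
  have hsum : N * ∑ p ∈ (N + 1).primesBelow, Real.log p / p ≤
      ∑ p ∈ (N + 1).primesBelow, Real.log p * (N / p : ℕ) +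
        ∑ p ∈ (N + 1).primesBelow, Real.log p := by
    rw [mul_sum, ← sum_add_distrib]
    refine sum_le_sum fun p hp ↦ ?_
    have h1 : (N : ℝ) / p ≤ (N / p : ℕ) + 1 := by
      rw [← Nat.floor_div_eq_div (K := ℝ)]
      exact (Nat.lt_floor_add_one _).le
    have h2 := mul_le_mul_of_nonneg_left h1 (Real.log_natCast_nonneg p)
    calc (N : ℝ) * (Real.log p / p) = Real.log p * (N / p) := by ring
      _ ≤ _ := h2
      _ = _ := by ring
  refine le_of_mul_le_mul_left ?_ hN0
  linarith

lemma tsum_nat_rpow_neg_le {s : ℝ} (hs : 1 < s) :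
    ∑' n : ℕ, (n : ℝ) ^ (-s) ≤ 1 + 1 / (s - 1) := by
  have h := ZetaAsymptotics.zeta_limit_aux1 hs
  have hnn : 0 ≤ ZetaAsymptotics.termTSum s :=
    tsum_nonneg fun n ↦ ZetaAsymptotics.term_nonneg _ _
  have hsumm : Summable fun n : ℕ ↦ (n : ℝ) ^ (-s) := Real.summable_nat_rpow.mpr (by linarith)
  rw [hsumm.tsum_eq_zero_add]
  have h0 : ((0 : ℕ) : ℝ) ^ (-s) = 0 := by
    rw [Nat.cast_zero, Real.zero_rpow (by linarith)]
  have h1 : ∑' n : ℕ, ((n + 1 : ℕ) : ℝ) ^ (-s) = ∑' n : ℕ, 1 / ((n : ℝ) + 1) ^ s := by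
    refine tsum_congr fun n ↦ ?_
    rw [Real.rpow_neg (by positivity), one_div]
    push_cast
    rfl
  rw [h0, h1, zero_add]
  nlinarith

lemma prod_primesBelow_one_sub_rpow_neg_inv_le {s : ℝ} (hs : 1 < s) (N : ℕ) :
    ∏ p ∈ N.primesBelow, (1 - (p : ℝ) ^ (-s))⁻¹ ≤ 1 + 1 / (s - 1) := by
  let f : ℕ →* ℝ :=
    { toFun := fun n ↦ (n : ℝ) ^ (-s)
      map_one' := by simp
      map_mul' := fun m n ↦ by
        push_cast
        exact Real.mul_rpow (Nat.cast_nonneg m) (Nat.cast_nonneg n) }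
  have hsumm : Summable fun n : ℕ ↦ (n : ℝ) ^ (-s) := Real.summable_nat_rpow.mpr (by linarith)
  have hf {p : ℕ} (hp : p.Prime) : ‖f p‖ < 1 := by
    change ‖(p : ℝ) ^ (-s)‖ < 1
    rw [Real.norm_of_nonneg (by positivity)]
    exact Real.rpow_lt_one_of_one_lt_of_neg (by exact_mod_cast hp.one_lt) (by linarith)
  have h := (EulerProduct.summable_and_hasSum_smoothNumbers_prod_primesBelow_geometric hf N).2
  calc ∏ p ∈ N.primesBelow, (1 - (p : ℝ) ^ (-s))⁻¹
      = ∑' m : N.smoothNumbers, (m : ℝ) ^ (-s) := h.tsum_eq.symm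
    _ ≤ ∑' n : ℕ, (n : ℝ) ^ (-s) :=
        Summable.tsum_subtype_le _ _ (fun n ↦ by positivity) hsumm
    _ ≤ _ := tsum_nat_rpow_neg_le hs

/-- A weak form of Mertens' third theorem. -/
lemma prod_primesBelow_one_sub_inv_inv_le {N : ℕ} (hN : 4 ≤ N) :
    ∏ p ∈ (N + 1).primesBelow, (1 - (p : ℝ)⁻¹)⁻¹ ≤ Real.exp 4 * (1 + Real.log N) := by
  have hN' : (4 : ℝ) ≤ N := by exact_mod_cast hN
  have hlog4 : Real.log 4 ≤ Real.log N := Real.log_le_log (by norm_num) hN'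
  have hlog4pos : 0 < Real.log 4 := Real.log_pos (by norm_num)
  have hlog : 0 < Real.log N := hlog4pos.trans_le hlog4
  set ε : ℝ := (Real.log N)⁻¹ with hε
  have hεpos : 0 < ε := inv_pos.mpr hlog
  have hterm : ∀ p ∈ (N + 1).primesBelow, (1 - (p : ℝ)⁻¹)⁻¹ ≤
      Real.exp (2 * ε * (Real.log p / p)) * (1 - (p : ℝ) ^ (-(1 + ε)))⁻¹ := fun p hp ↦ by
    have hp2 : (2 : ℝ) ≤ p := by exact_mod_cast (Nat.prime_of_mem_primesBelow hp).two_le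
    have hp0 : (0 : ℝ) < p := by linarith
    have hlogp : 0 ≤ Real.log p := Real.log_natCast_nonneg p
    have hhalf : (p : ℝ)⁻¹ ≤ 1 / 2 := by
      rw [one_div]; exact inv_anti₀ (by norm_num) hp2
    have hpow : (p : ℝ) ^ (-(1 + ε)) = (p : ℝ)⁻¹ * Real.exp (-(ε * Real.log p)) := by
      rw [neg_add, Real.rpow_add hp0, Real.rpow_neg_one, Real.rpow_def_of_pos hp0]
      ring_nf
    have hexp : 1 - ε * Real.log p ≤ Real.exp (-(ε * Real.log p)) := by
      linarith [Real.add_one_le_exp (-(ε * Real.log p))]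
    have hexp1 : Real.exp (-(ε * Real.log p)) ≤ 1 :=
      Real.exp_le_one_iff.mpr (neg_nonpos.mpr (by positivity))
    have hinv : 0 < (p : ℝ)⁻¹ := inv_pos.mpr hp0
    have hpos : 0 < 1 - (p : ℝ) ^ (-(1 + ε)) := by rw [hpow]; nlinarith
    rw [← div_eq_mul_inv, le_div_iff₀ hpos, inv_mul_le_iff₀ (by linarith)]
    have hE := Real.add_one_le_exp (2 * ε * (Real.log p / p))
    have hu : 0 ≤ ε * Real.log p * (p : ℝ)⁻¹ := by positivity
    calc 1 - (p : ℝ) ^ (-(1 + ε)) ≤ (1 - (p : ℝ)⁻¹) + ε * Real.log p * (p : ℝ)⁻¹ := by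
          rw [hpow]; nlinarith
      _ ≤ (1 - (p : ℝ)⁻¹) * (2 * ε * (Real.log p / p) + 1) := by
          rw [div_eq_mul_inv]; nlinarith
      _ ≤ _ := mul_le_mul_of_nonneg_left hE (by linarith)
  have hsum := sum_primesBelow_log_div_le (N := N) (by omega)
  have hexpo : 2 * ε * ∑ p ∈ (N + 1).primesBelow, Real.log p / p ≤ 4 := by
    have : ε * ∑ p ∈ (N + 1).primesBelow, Real.log p / p ≤ 2 := by
      rw [hε, inv_mul_le_iff₀ hlog]; linarith
    linarith
  calc ∏ p ∈ (N + 1).primesBelow, (1 - (p : ℝ)⁻¹)⁻¹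
      ≤ ∏ p ∈ (N + 1).primesBelow,
          Real.exp (2 * ε * (Real.log p / p)) * (1 - (p : ℝ) ^ (-(1 + ε)))⁻¹ :=
        prod_le_prod (fun p hp ↦ inv_nonneg.mpr (sub_nonneg.mpr (inv_le_one_of_one_le₀
          (by exact_mod_cast (Nat.prime_of_mem_primesBelow hp).one_lt.le)))) hterm
    _ = Real.exp (2 * ε * ∑ p ∈ (N + 1).primesBelow, Real.log p / p) *
          ∏ p ∈ (N + 1).primesBelow, (1 - (p : ℝ) ^ (-(1 + ε)))⁻¹ := by
        rw [prod_mul_distrib, ← Real.exp_sum, mul_sum]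
    _ ≤ Real.exp 4 * (1 + 1 / (1 + ε - 1)) := by
        refine mul_le_mul (Real.exp_le_exp.mpr hexpo)
          (prod_primesBelow_one_sub_rpow_neg_inv_le (by linarith) _) ?_ (Real.exp_nonneg _)
        refine prod_nonneg fun p hp ↦ inv_nonneg.mpr (sub_nonneg.mpr ?_)
        exact Real.rpow_le_one_of_one_le_of_nonpos
          (by exact_mod_cast (Nat.prime_of_mem_primesBelow hp).one_lt.le) (by linarith)
    _ = _ := by rw [add_sub_cancel_left, hε, one_div, inv_inv]

lemma abs_sum_range_mul_le_of_antitone {b c : ℕ → ℝ} {M : ℝ} (hb : Antitone b)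
    (hb0 : ∀ n, 0 ≤ b n) (hc : ∀ n, |∑ i ∈ range n, c i| ≤ M) (n : ℕ) :
    |∑ i ∈ range n, b i * c i| ≤ M * b 0 := by
  have h := sum_range_by_parts b c n
  simp only [smul_eq_mul] at h
  rw [h]
  have h2 : |∑ i ∈ range (n - 1), (b (i + 1) - b i) * ∑ j ∈ range (i + 1), c j| ≤
      (b 0 - b (n - 1)) * M := by
    refine (abs_sum_le_sum_abs _ _).trans ?_
    rw [← sum_range_sub', sum_mul]
    refine sum_le_sum fun i _ ↦ ?_
    have hi : b (i + 1) ≤ b i := hb (Nat.le_succ i)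
    rw [abs_mul, abs_of_nonpos (by linarith), neg_sub]
    exact mul_le_mul_of_nonneg_left (hc _) (by linarith)
  have h1 : |b (n - 1) * ∑ i ∈ range n, c i| ≤ b (n - 1) * M := by
    rw [abs_mul, abs_of_nonneg (hb0 _)]
    exact mul_le_mul_of_nonneg_left (hc _) (hb0 _)
  refine (abs_sub _ _).trans ?_
  linarith

lemma add_one_mul_pow_le_geom_sum_sq {t : ℝ} (ht : 0 ≤ t) (n : ℕ) :
    (n + 1) * t ^ n ≤ ∑ j ∈ range (n + 1), (t ^ 2) ^ j := by
  have key (n : ℕ) : (n + 1) * t ^ n ≤ 1 + n * t ^ (n + 1) := by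
    induction n with
    | zero => simp
    | succ n ih =>
      have : 0 ≤ (n + 1) * t ^ n * (1 - t) ^ 2 := by positivity
      push_cast
      ring_nf at this ih ⊢
      linarith
  induction n with
  | zero => simp
  | succ n ih =>
    rw [geom_sum_succ]
    have h1 := key (n + 1)
    have h2 := mul_le_mul_of_nonneg_left ih (sq_nonneg t)
    push_cast at h1 ⊢
    calc _ ≤ _ := h1
      _ = t ^ 2 * ((n + 1) * t ^ n) + 1 := by ring
      _ ≤ _ := by linarith

/-- The error made on replacing `r ^ n / (1 - r ^ n)` by `1 / (n (1 - r))`, at `n = i + 1`. -/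
noncomputable def lambertError (r : ℝ) (i : ℕ) : ℝ :=
  1 / ((i + 1) * (1 - r)) - r ^ (i + 1) / (1 - r ^ (i + 1))

lemma lambertError_zero {r : ℝ} (h1 : r < 1) : lambertError r 0 = 1 := by
  have : 1 - r ≠ 0 := by linarith
  simp only [lambertError, Nat.cast_zero, zero_add, one_mul, pow_one]
  field_simp

lemma lambertError_nonneg {r : ℝ} (h0 : 0 ≤ r) (h1 : r < 1) (i : ℕ) : 0 ≤ lambertError r i := by
  have hr : 0 < 1 - r := by linarith
  have hpow : 0 < 1 - r ^ (i + 1) := sub_pos.mpr (pow_lt_one₀ h0 h1 (Nat.succ_ne_zero i))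
  rw [lambertError, sub_nonneg, div_le_div_iff₀ hpow (by positivity), one_mul,
    ← mul_neg_geom_sum r (i + 1)]
  have hG : ((i : ℝ) + 1) * r ^ (i + 1) ≤ ∑ j ∈ range (i + 1), r ^ j := by
    have := card_nsmul_le_sum (range (i + 1)) (fun j ↦ r ^ j) (r ^ (i + 1)) fun j hj ↦
      pow_le_pow_of_le_one h0 h1.le (mem_range.mp hj).le
    simpa using this
  nlinarith

lemma lambertError_antitone {t : ℝ} (h0 : 0 ≤ t) (h1 : t < 1) :
    Antitone (lambertError (t ^ 2)) := by
  refine antitone_nat_of_succ_le fun i ↦ ?_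
  have hr0 : 0 ≤ t ^ 2 := sq_nonneg t
  have hr1 : t ^ 2 < 1 := pow_lt_one₀ h0 h1 two_ne_zero
  set r := t ^ 2 with hrt
  have hr : 0 < 1 - r := by linarith
  have hG1 := add_one_mul_pow_le_geom_sum_sq h0 i
  have hG2 := add_one_mul_pow_le_geom_sum_sq h0 (i + 1)
  have e1 := mul_neg_geom_sum r (i + 1)
  have e2 := mul_neg_geom_sum r (i + 1 + 1)
  have e3 := geom_sum_succ (x := r) (n := i + 1)
  set G1 := ∑ j ∈ range (i + 1), r ^ j
  set G2 := ∑ j ∈ range (i + 1 + 1), r ^ j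
  have hG1pos : 0 < G1 := geom_sum_pos hr0 (Nat.succ_ne_zero _)
  have hG2pos : 0 < G2 := geom_sum_pos hr0 (Nat.succ_ne_zero _)
  have hGG : ((i : ℝ) + 1) * (i + 2) * r ^ (i + 1) ≤ G1 * G2 := by
    calc ((i : ℝ) + 1) * (i + 2) * r ^ (i + 1)
        = ((i : ℝ) + 1) * (i + 2) * t ^ (2 * i + 1) * t := by rw [hrt]; ring
      _ ≤ ((i : ℝ) + 1) * (i + 2) * t ^ (2 * i + 1) * 1 := by gcongr
      _ = (((i : ℝ) + 1) * t ^ i) * (((i + 1 : ℕ) + 1) * t ^ (i + 1)) := by push_cast; ring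
      _ ≤ G1 * G2 := mul_le_mul hG1 hG2 (by positivity) hG1pos.le
  have hdiff : r ^ (i + 1) / (1 - r ^ (i + 1)) - r ^ (i + 1 + 1) / (1 - r ^ (i + 1 + 1)) ≤
      1 / ((i + 1) * (1 - r)) - 1 / (((i + 1 : ℕ) + 1) * (1 - r)) := by
    have hl : r ^ (i + 1) / (1 - r ^ (i + 1)) - r ^ (i + 1 + 1) / (1 - r ^ (i + 1 + 1)) =
        r ^ (i + 1) / ((1 - r) * (G1 * G2)) := by
      rw [← e1, ← e2]
      field_simp
      linear_combination r ^ (i + 1) * e3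
    have hrr : 1 / ((i + 1) * (1 - r)) - 1 / (((i + 1 : ℕ) + 1) * (1 - r)) =
        1 / ((1 - r) * ((i + 1) * (i + 2))) := by
      push_cast
      field_simp
      ring
    rw [hl, hrr, div_le_div_iff₀ (by positivity) (by positivity)]
    nlinarith
  simp only [lambertError]
  linarith

namespace DirichletCharacter

variable {q : ℕ} [NeZero q]

lemma sum_range_add_natCast_eq_zero {χ : DirichletCharacter ℝ q} (hχ : χ ≠ 1) (a : ZMod q) :
    ∑ i ∈ range q, χ (a + i) = 0 := by
  rw [← MulChar.sum_eq_zero_of_ne_one hχ, ← Equiv.sum_comp (Equiv.addLeft a) χ]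
  refine sum_bij' (fun i _ ↦ (i : ZMod q)) (fun x _ ↦ x.val) (fun _ _ ↦ mem_univ _)
    (fun x _ ↦ mem_range.mpr x.val_lt) (fun i hi ↦ ?_) (fun x _ ↦ ?_) (fun i _ ↦ rfl)
  · exact ZMod.val_cast_of_lt (mem_range.mp hi)
  · exact ZMod.natCast_zmod_val x

lemma abs_sum_range_add_natCast_le {χ : DirichletCharacter ℝ q} (hχ : χ ≠ 1) (a : ZMod q)
    (n : ℕ) : |∑ i ∈ range n, χ (a + i)| ≤ q := by
  induction n using Nat.strong_induction_on with
  | _ n ih =>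
    rcases lt_or_ge n q with hn | hn
    · calc |∑ i ∈ range n, χ (a + i)| ≤ ∑ i ∈ range n, |χ (a + i)| := abs_sum_le_sum_abs _ _
        _ ≤ ∑ i ∈ range n, 1 := sum_le_sum fun i _ ↦ χ.norm_le_one _
        _ ≤ q := by simpa using hn.le
    · obtain ⟨m, rfl⟩ := Nat.exists_eq_add_of_le' hn
      have h := sum_range_add_natCast_eq_zero hχ (a + m)
      rw [sum_range_add]
      simp only [Nat.cast_add, ← add_assoc, h, add_zero]
      exact ih m (by have := NeZero.pos q; omega)

end DirichletCharacter

namespace DirichletCharacter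

variable {q : ℕ}

/-- The Dirichlet convolution of the constant function `1` with a real character. -/
noncomputable def divisorSum (χ : DirichletCharacter ℝ q) (n : ℕ) : ℝ :=
  ∑ d ∈ n.divisors, χ (d : ZMod q)

lemma divisorSum_zero (χ : DirichletCharacter ℝ q) : χ.divisorSum 0 = 0 := by
  simp [divisorSum]

lemma divisorSum_one (χ : DirichletCharacter ℝ q) : χ.divisorSum 1 = 1 := by
  simp [divisorSum]

lemma toArithmeticFunction_mul_zeta_apply (χ : DirichletCharacter ℝ q) (n : ℕ) :
    (toArithmeticFunction (fun m : ℕ ↦ χ (m : ZMod q)) *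
      (ArithmeticFunction.zeta : ArithmeticFunction ℝ)) n =
      χ.divisorSum n := by
  rw [ArithmeticFunction.coe_mul_zeta_apply, divisorSum]
  refine sum_congr rfl fun d hd ↦ ?_
  simp [toArithmeticFunction, (Nat.pos_of_mem_divisors hd).ne']

lemma isMultiplicative_toArithmeticFunction_mul_zeta (χ : DirichletCharacter ℝ q) :
    (toArithmeticFunction (fun m : ℕ ↦ χ (m : ZMod q)) *
      (ArithmeticFunction.zeta : ArithmeticFunction ℝ)).IsMultiplicative :=
  χ.isMultiplicative_toArithmeticFunction.mul ArithmeticFunction.isMultiplicative_zeta.natCast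

lemma divisorSum_mul_of_coprime (χ : DirichletCharacter ℝ q) {m n : ℕ} (h : m.Coprime n) :
    χ.divisorSum (m * n) = χ.divisorSum m * χ.divisorSum n := by
  simp only [← toArithmeticFunction_mul_zeta_apply]
  exact χ.isMultiplicative_toArithmeticFunction_mul_zeta.map_mul_of_coprime h

lemma divisorSum_prime_pow (χ : DirichletCharacter ℝ q) {p : ℕ} (hp : p.Prime) (k : ℕ) :
    χ.divisorSum (p ^ k) = ∑ i ∈ range (k + 1), χ (p : ZMod q) ^ i := by
  rw [divisorSum, Nat.sum_divisors_prime_pow hp]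
  simp

lemma abs_divisorSum_le (χ : DirichletCharacter ℝ q) (n : ℕ) : |χ.divisorSum n| ≤ n :=
  calc |χ.divisorSum n| ≤ ∑ d ∈ n.divisors, |χ (d : ZMod q)| := abs_sum_le_sum_abs _ _
    _ ≤ ∑ d ∈ n.divisors, 1 := sum_le_sum fun d _ ↦ χ.norm_le_one _
    _ = (n.divisors.card : ℝ) := by simp
    _ ≤ n := by exact_mod_cast Nat.card_divisors_le_self n

lemma divisorSum_nonneg {χ : DirichletCharacter ℝ q} (hχ : χ ^ 2 = 1) (n : ℕ) :
    0 ≤ χ.divisorSum n := by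
  rcases eq_or_ne n 0 with rfl | hn
  · exact χ.divisorSum_zero.ge
  rw [← toArithmeticFunction_mul_zeta_apply,
    χ.isMultiplicative_toArithmeticFunction_mul_zeta.multiplicative_factorization _ hn]
  refine prod_nonneg fun p hp ↦ ?_
  dsimp only
  rw [toArithmeticFunction_mul_zeta_apply,
    divisorSum_prime_pow χ (Nat.prime_of_mem_primeFactors hp)]
  rcases MulChar.isQuadratic_iff_sq_eq_one.mpr hχ (p : ZMod q) with h | h | h
  · exact sum_nonneg fun i _ ↦ by simp [h]
  · exact sum_nonneg fun i _ ↦ by simp [h]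
  · rw [h, neg_one_geom_sum]
    split_ifs
    exacts [le_rfl, zero_le_one]

lemma summable_prod_apply_mul_pow (χ : DirichletCharacter ℝ q) {r : ℝ} (h0 : 0 ≤ r) (h1 : r < 1) :
    Summable fun c : ℕ+ × ℕ+ ↦ χ ((c.1 : ℕ) : ZMod q) * r ^ (c.1 * c.2 : ℕ) := by
  have h := summable_prod_mul_pow 0 (r := r) (by rwa [Real.norm_of_nonneg h0])
  refine Summable.of_norm_bounded h fun c ↦ ?_
  rw [norm_mul, pow_zero, one_mul, Real.norm_of_nonneg (pow_nonneg h0 _)]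
  exact mul_le_of_le_one_left (pow_nonneg h0 _) (χ.norm_le_one _)

lemma hasSum_divisorSum_mul_pow (χ : DirichletCharacter ℝ q) {r : ℝ} (h0 : 0 ≤ r) (h1 : r < 1) :
    HasSum (fun n ↦ χ.divisorSum n * r ^ n)
      (∑' c : ℕ+ × ℕ+, χ ((c.1 : ℕ) : ZMod q) * r ^ (c.1 * c.2 : ℕ)) := by
  have h := (χ.summable_prod_apply_mul_pow h0 h1).hasSum
  rw [← sigmaAntidiagonalEquivProd.hasSum_iff] at h
  have h2 := h.sigma fun n ↦ (hasSum_fintype _)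
  rw [← PNat.coe_injective.hasSum_iff]
  · refine h2.congr_fun fun n ↦ ?_
    have hfac (x : (n : ℕ).divisorsAntidiagonal) :
        χ (((sigmaAntidiagonalEquivProd ⟨n, x⟩).1 : ℕ) : ZMod q) *
          r ^ ((sigmaAntidiagonalEquivProd ⟨n, x⟩).1 * (sigmaAntidiagonalEquivProd ⟨n, x⟩).2 : ℕ) =
        χ ((x.1.1 : ℕ) : ZMod q) * r ^ (n : ℕ) :=
      congrArg (χ ((x.1.1 : ℕ) : ZMod q) * r ^ ·) (Nat.mem_divisorsAntidiagonal.mp x.2).1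
    simp only [Function.comp_apply, divisorSum]
    rw [sum_congr rfl fun x _ ↦ hfac x, ← sum_mul, univ_eq_attach,
      sum_attach _ fun x : ℕ × ℕ ↦ χ (x.1 : ZMod q),
      Nat.sum_divisorsAntidiagonal fun x _ ↦ χ (x : ZMod q)]
  · intro n hn
    have : n = 0 := by
      by_contra h
      exact hn ⟨⟨n, Nat.pos_of_ne_zero h⟩, rfl⟩
    simp [this, divisorSum_zero]

lemma hasSum_lambert (χ : DirichletCharacter ℝ q) {r : ℝ} (h0 : 0 ≤ r) (h1 : r < 1) :
    HasSum (fun i : ℕ ↦ χ ((i + 1 : ℕ) : ZMod q) * (r ^ (i + 1) / (1 - r ^ (i + 1))))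
      (∑' n, χ.divisorSum n * r ^ n) := by
  rw [(χ.hasSum_divisorSum_mul_pow h0 h1).tsum_eq]
  have h := (χ.summable_prod_apply_mul_pow h0 h1).hasSum.prod_fiberwise
    (g := fun d : ℕ+ ↦ χ ((d : ℕ) : ZMod q) * (r ^ (d : ℕ) / (1 - r ^ (d : ℕ)))) fun d ↦ ?_
  · rwa [← Equiv.pnatEquivNat.symm.hasSum_iff] at h
  · have hpow : r ^ (d : ℕ) < 1 := pow_lt_one₀ h0 h1 d.ne_zero
    have hg := ((hasSum_geometric_of_lt_one (pow_nonneg h0 d) hpow).mul_left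
      (χ ((d : ℕ) : ZMod q) * r ^ (d : ℕ)))
    rw [← Equiv.pnatEquivNat.hasSum_iff] at hg
    rw [← div_eq_mul_inv, mul_div_assoc] at hg
    refine hg.congr_fun fun m ↦ ?_
    have hm : (m : ℕ) = m.natPred + 1 := (PNat.natPred_add_one m).symm
    simp only [Function.comp_apply, Equiv.pnatEquivNat_apply]
    rw [hm]
    ring

end DirichletCharacter

namespace DirichletCharacter

variable {q : ℕ} [NeZero q]

/-- The value at `s` of the `L`-function of a real character, as a real number. -/
noncomputable def realLFunction (χ : DirichletCharacter ℝ q) (s : ℝ) : ℝ :=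
  (LFunction (χ.ringHomComp (algebraMap ℝ ℂ)) s).re

lemma continuous_realLFunction {χ : DirichletCharacter ℝ q} (hχ : χ ≠ 1) :
    Continuous χ.realLFunction := by
  have h : χ.ringHomComp (algebraMap ℝ ℂ) ≠ 1 :=
    (MulChar.ringHomComp_ne_one_iff (algebraMap ℝ ℂ).injective).mpr hχ
  exact Complex.continuous_re.comp
    ((differentiable_LFunction h).continuous.comp Complex.continuous_ofReal)

lemma hasSum_realLFunction (χ : DirichletCharacter ℝ q) {s : ℝ} (hs : 1 < s) :
    HasSum (fun i : ℕ ↦ ((i + 1 : ℕ) : ℝ) ^ (-s) * χ ((i + 1 : ℕ) : ZMod q))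
      (χ.realLFunction s) := by
  have hsumm : LSeriesSummable (fun n ↦ χ.ringHomComp (algebraMap ℝ ℂ) n) s :=
    LSeriesSummable_of_bounded_of_one_lt_re (m := 1) (fun n _ ↦ norm_le_one _ _) (by simpa using hs)
  have h := hsumm.hasSum
  rw [← LSeries, ← LFunction_eq_LSeries _ (by simpa using hs), ← hasSum_nat_add_iff' 1] at h
  have h2 := Complex.hasSum_re h
  simp only [range_one, sum_singleton, LSeries.term_zero, sub_zero] at h2
  refine h2.congr_fun fun i ↦ ?_
  rw [LSeries.term_of_ne_zero (Nat.succ_ne_zero i)]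
  have hc : (((i + 1 : ℕ) : ℝ) ^ (-s) : ℝ) = (((i + 1 : ℕ) : ℂ) ^ (s : ℂ))⁻¹ := by
    rw [Real.rpow_neg (Nat.cast_nonneg _), Complex.ofReal_inv,
      Complex.ofReal_cpow (Nat.cast_nonneg _)]
    simp
  rw [div_eq_mul_inv, ← hc, MulChar.ringHomComp_apply, Complex.coe_algebraMap,
    ← Complex.ofReal_mul, Complex.ofReal_re, mul_comm]

lemma abs_sum_range_sub_realLFunction_one_le {χ : DirichletCharacter ℝ q} (hχ : χ ≠ 1) (N : ℕ) :
    |∑ i ∈ range N, ((i + 1 : ℕ) : ℝ) ^ (-1 : ℝ) * χ ((i + 1 : ℕ) : ZMod q) -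
      χ.realLFunction 1| ≤ q / (N + 1) := by
  have key (s : ℝ) (hs : 1 < s) :
      |∑ i ∈ range N, ((i + 1 : ℕ) : ℝ) ^ (-s) * χ ((i + 1 : ℕ) : ZMod q) -
        χ.realLFunction s| ≤ q / (N + 1) := by
    have hlim := ((hasSum_nat_add_iff' N).mpr (χ.hasSum_realLFunction hs)).tendsto_sum_nat.abs
    rw [abs_sub_comm]
    refine le_of_tendsto' hlim fun n ↦ ?_
    have hanti : Antitone fun i : ℕ ↦ ((i + N + 1 : ℕ) : ℝ) ^ (-s) := fun i j hij ↦
      Real.rpow_le_rpow_of_nonpos (by positivity) (by exact_mod_cast (by omega)) (by linarith)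
    have h := abs_sum_range_mul_le_of_antitone (c := fun i ↦ χ ((i + N + 1 : ℕ) : ZMod q))
      (M := q) hanti (fun i ↦ by positivity) (fun n ↦ ?_) n
    · refine h.trans ?_
      rw [div_eq_mul_inv]
      refine mul_le_mul_of_nonneg_left ?_ (Nat.cast_nonneg q)
      rw [← Real.rpow_neg_one]
      push_cast
      rw [zero_add]
      exact Real.rpow_le_rpow_of_exponent_le (by linarith [(Nat.cast_nonneg N : (0 : ℝ) ≤ N)])
        (by linarith)
    · convert abs_sum_range_add_natCast_le hχ ((N + 1 : ℕ) : ZMod q) n using 5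
      push_cast
      ring
  have hcont : Continuous fun s : ℝ ↦
      |∑ i ∈ range N, ((i + 1 : ℕ) : ℝ) ^ (-s) * χ ((i + 1 : ℕ) : ZMod q) -
        χ.realLFunction s| := by
    refine ((continuous_finsetSum _ fun i _ ↦ ?_).sub (continuous_realLFunction hχ)).abs
    exact (Real.continuous_const_rpow (by positivity)).comp continuous_neg |>.mul continuous_const
  have hlim := (hcont.tendsto 1).mono_left (nhdsWithin_le_nhds (s := Set.Ioi 1))
  exact le_of_tendsto hlim (Filter.eventually_of_mem self_mem_nhdsWithin key)

open Filter Topology in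
lemma tendsto_sum_range_realLFunction_one {χ : DirichletCharacter ℝ q} (hχ : χ ≠ 1) :
    Tendsto (fun N ↦ ∑ i ∈ range N, ((i + 1 : ℕ) : ℝ) ^ (-1 : ℝ) * χ ((i + 1 : ℕ) : ZMod q))
      atTop (𝓝 (χ.realLFunction 1)) := by
  rw [tendsto_iff_norm_sub_tendsto_zero]
  refine squeeze_zero (fun _ ↦ norm_nonneg _) (abs_sum_range_sub_realLFunction_one_le hχ) ?_
  simpa [div_eq_mul_inv] using (tendsto_one_div_add_atTop_nhds_zero_nat (𝕜 := ℝ)).const_mul (q : ℝ)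

lemma realLFunction_one_le {χ : DirichletCharacter ℝ q} (hχ : χ ≠ 1) {t : ℝ} (h0 : 0 ≤ t)
    (h1 : t < 1) :
    χ.realLFunction 1 ≤ (1 - t ^ 2) * ∑' n, χ.divisorSum n * (t ^ 2) ^ n + q * (1 - t ^ 2) := by
  have hr0 : 0 ≤ t ^ 2 := sq_nonneg t
  have hr1 : t ^ 2 < 1 := pow_lt_one₀ h0 h1 two_ne_zero
  have hanti := lambertError_antitone h0 h1
  set r := t ^ 2
  have hr : 0 < 1 - r := by linarith
  have hlim := ((tendsto_sum_range_realLFunction_one hχ).const_mul (1 - r)⁻¹).sub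
    (χ.hasSum_lambert hr0 hr1).tendsto_sum_nat
  have hle : (1 - r)⁻¹ * χ.realLFunction 1 - ∑' n, χ.divisorSum n * r ^ n ≤ q := by
    refine le_of_tendsto' hlim fun N ↦ ?_
    have h := abs_sum_range_mul_le_of_antitone (c := fun i ↦ χ ((i + 1 : ℕ) : ZMod q)) (M := q)
      hanti (lambertError_nonneg hr0 hr1) (fun n ↦ ?_) N
    · rw [lambertError_zero hr1, mul_one] at h
      refine le_of_eq_of_le ?_ ((le_abs_self _).trans h)
      rw [mul_sum, ← sum_sub_distrib]
      refine sum_congr rfl fun i _ ↦ ?_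
      rw [lambertError, Real.rpow_neg_one, one_div, mul_inv]
      push_cast
      ring
    · convert abs_sum_range_add_natCast_le hχ 1 n using 5
      push_cast
      ring
  rw [sub_le_iff_le_add, inv_mul_le_iff₀ hr] at hle
  linarith

end DirichletCharacter

lemma mul_one_sub_mul_pow_le {s : ℝ} (h0 : 0 ≤ s) (h1 : s ≤ 1) (n : ℕ) :
    n * ((1 - s ^ 2) * (s ^ 2) ^ n) ≤ 2 * (s ^ n - (s ^ 2) ^ n) := by
  have hpow : 0 ≤ s ^ n := pow_nonneg h0 n
  have hG : (n : ℝ) * s ^ n ≤ ∑ j ∈ range n, s ^ j := by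
    have := card_nsmul_le_sum (range n) (fun j ↦ s ^ j) (s ^ n) fun j hj ↦
      pow_le_pow_of_le_one h0 h1 (mem_range.mp hj).le
    simpa using this
  have h2 : (1 - s) * (n * s ^ n) ≤ 1 - s ^ n := by
    rw [← mul_neg_geom_sum s n]
    exact mul_le_mul_of_nonneg_left hG (by linarith)
  calc n * ((1 - s ^ 2) * (s ^ 2) ^ n) = (1 + s) * s ^ n * ((1 - s) * (n * s ^ n)) := by ring
    _ ≤ (1 + s) * s ^ n * (1 - s ^ n) := mul_le_mul_of_nonneg_left h2 (by positivity)
    _ ≤ 2 * s ^ n * (1 - s ^ n) :=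
      mul_le_mul_of_nonneg_right (by nlinarith) (by linarith [pow_le_one₀ h0 h1 (n := n)])
    _ = _ := by ring

namespace DirichletCharacter

variable {q : ℕ}

lemma summable_divisorSum_div_mul_pow (χ : DirichletCharacter ℝ q) {r : ℝ} (h0 : 0 ≤ r)
    (h1 : r < 1) : Summable fun n : ℕ ↦ χ.divisorSum n / n * r ^ n := by
  refine Summable.of_norm_bounded (summable_geometric_of_lt_one h0 h1) fun n ↦ ?_
  rw [norm_mul, Real.norm_of_nonneg (pow_nonneg h0 n)]
  refine mul_le_of_le_one_left (pow_nonneg h0 n) ?_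
  rw [norm_div, Real.norm_natCast]
  exact div_le_one_of_le₀ (χ.abs_divisorSum_le n) (Nat.cast_nonneg n)

lemma mul_realLFunction_one_le [NeZero q] {χ : DirichletCharacter ℝ q} (hχ2 : χ ^ 2 = 1)
    (hχ : χ ≠ 1) (K : ℕ) :
    K * χ.realLFunction 1 ≤
      2 * ∑' n : ℕ, χ.divisorSum n / n * Real.exp (-1 / (q * 2 ^ K)) ^ n + 2 := by
  have hq : (0 : ℝ) < q := Nat.cast_pos.mpr (NeZero.pos q)
  set r : ℕ → ℝ := fun k ↦ Real.exp (-1 / (q * 2 ^ k)) with hr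
  have hr0 (k : ℕ) : 0 ≤ r k := Real.exp_nonneg _
  have hr1 (k : ℕ) : r k < 1 :=
    Real.exp_lt_one_iff.mpr (div_neg_of_neg_of_pos (by norm_num) (by positivity))
  have hsq (k : ℕ) : r k = r (k + 1) ^ 2 := by
    simp only [hr]
    rw [← Real.exp_nat_mul]
    congr 1
    field_simp
    push_cast
    ring
  have hsub (k : ℕ) : q * (1 - r k) ≤ (1 / 2) ^ k := by
    have h := Real.add_one_le_exp (-1 / (q * 2 ^ k))
    calc q * (1 - r k) ≤ q * (1 / (q * 2 ^ k)) :=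
          mul_le_mul_of_nonneg_left (by rw [neg_div] at h; simp only [hr]; rw [neg_div]; linarith)
            hq.le
      _ = (1 / 2) ^ k := by rw [one_div_pow]; field_simp
  have hL (k : ℕ) : χ.realLFunction 1 ≤
      (1 - r k) * ∑' n, χ.divisorSum n * r k ^ n + q * (1 - r k) := by
    have h := realLFunction_one_le hχ (hr0 (k + 1)) (hr1 (k + 1))
    rwa [← hsq] at h
  have hsumm (k : ℕ) : Summable fun n ↦ χ.divisorSum n * r k ^ n :=
    (χ.hasSum_divisorSum_mul_pow (hr0 k) (hr1 k)).summable
  have hmain : ∑ k ∈ range K, (1 - r k) * ∑' n, χ.divisorSum n * r k ^ n ≤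
      2 * ∑' n : ℕ, χ.divisorSum n / n * r K ^ n := by
    refine hasSum_le (fun n ↦ ?_)
      (hasSum_sum fun k (_ : k ∈ range K) ↦ (hsumm k).hasSum.mul_left (1 - r k))
      ((χ.summable_divisorSum_div_mul_pow (hr0 K) (hr1 K)).hasSum.mul_left 2)
    rcases eq_or_ne n 0 with rfl | hn
    · simp [divisorSum_zero]
    have hn0 : (0 : ℝ) < n := Nat.cast_pos.mpr (Nat.pos_of_ne_zero hn)
    have htel : ∑ k ∈ range K, n * ((1 - r k) * r k ^ n) ≤ 2 * r K ^ n := by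
      calc ∑ k ∈ range K, n * ((1 - r k) * r k ^ n)
          ≤ ∑ k ∈ range K, 2 * (r (k + 1) ^ n - r k ^ n) := sum_le_sum fun k _ ↦ by
            rw [hsq k]
            exact mul_one_sub_mul_pow_le (hr0 _) (hr1 _).le n
        _ = 2 * (r K ^ n - r 0 ^ n) := by rw [← mul_sum, sum_range_sub (fun k ↦ r k ^ n)]
        _ ≤ 2 * r K ^ n := by linarith [pow_nonneg (hr0 0) n]
    calc ∑ k ∈ range K, (1 - r k) * (χ.divisorSum n * r k ^ n)
        = χ.divisorSum n / n * ∑ k ∈ range K, n * ((1 - r k) * r k ^ n) := by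
          rw [mul_sum]
          refine sum_congr rfl fun k _ ↦ ?_
          field_simp
      _ ≤ χ.divisorSum n / n * (2 * r K ^ n) :=
          mul_le_mul_of_nonneg_left htel (div_nonneg (divisorSum_nonneg hχ2 n) hn0.le)
      _ = _ := by ring
  calc K * χ.realLFunction 1 = ∑ k ∈ range K, χ.realLFunction 1 := by simp
    _ ≤ ∑ k ∈ range K, ((1 - r k) * ∑' n, χ.divisorSum n * r k ^ n + (1 / 2) ^ k) :=
        sum_le_sum fun k _ ↦ (hL k).trans (by linarith [hsub k])
    _ ≤ _ := by
        rw [sum_add_distrib]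
        exact add_le_add hmain (sum_geometric_two_le K)

lemma hasSum_smoothNumbers_divisorSum_div (χ : DirichletCharacter ℝ q) (N : ℕ) :
    HasSum (fun m : N.smoothNumbers ↦ χ.divisorSum m / (m : ℕ))
      (∏ p ∈ N.primesBelow, ((1 - (p : ℝ)⁻¹)⁻¹ * (1 - χ (p : ZMod q) / p)⁻¹)) := by
  have hloc {p : ℕ} (hp : p.Prime) :
      (Summable fun k : ℕ ↦ ‖χ.divisorSum (p ^ k) / ((p ^ k : ℕ) : ℝ)‖) ∧
      ∑' k : ℕ, χ.divisorSum (p ^ k) / ((p ^ k : ℕ) : ℝ) =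
        (1 - (p : ℝ)⁻¹)⁻¹ * (1 - χ (p : ZMod q) / p)⁻¹ := by
    have hp1 : (1 : ℝ) < p := by exact_mod_cast hp.one_lt
    have ha : ‖χ (p : ZMod q) / p‖ < 1 := by
      rw [norm_div, Real.norm_natCast, div_lt_one (by linarith)]
      exact (χ.norm_le_one _).trans_lt hp1
    have hb : ‖(p : ℝ)⁻¹‖ < 1 := by
      rw [norm_inv, Real.norm_natCast]
      exact inv_lt_one_of_one_lt₀ hp1
    have hsa := summable_norm_geometric_of_norm_lt_one ha
    have hsb := summable_norm_geometric_of_norm_lt_one hb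
    have heq (k : ℕ) : χ.divisorSum (p ^ k) / ((p ^ k : ℕ) : ℝ) =
        ∑ ij ∈ antidiagonal k, (χ (p : ZMod q) / p) ^ ij.1 * (p : ℝ)⁻¹ ^ ij.2 := by
      rw [divisorSum_prime_pow χ hp, sum_div,
        Nat.sum_antidiagonal_eq_sum_range_succ (fun i j ↦ (χ (p : ZMod q) / p) ^ i * (p : ℝ)⁻¹ ^ j)]
      refine sum_congr rfl fun i hi ↦ ?_
      have hk : k = i + (k - i) := by have := mem_range.mp hi; omega
      rw [div_pow, inv_pow, div_eq_mul_inv, div_eq_mul_inv, mul_assoc, ← mul_inv, ← pow_add, ← hk,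
        Nat.cast_pow]
    simp only [heq]
    refine ⟨summable_norm_sum_mul_antidiagonal_of_summable_norm hsa hsb, ?_⟩
    rw [← tsum_mul_tsum_eq_tsum_sum_antidiagonal_of_summable_norm hsa hsb,
      tsum_geometric_of_norm_lt_one ha, tsum_geometric_of_norm_lt_one hb, mul_comm]
  have h := (EulerProduct.summable_and_hasSum_smoothNumbers_prod_primesBelow_tsum
    (f := fun n ↦ χ.divisorSum n / n) (by simp [divisorSum_one])
    (fun {m n} hmn ↦ by
      simp only [divisorSum_mul_of_coprime χ hmn, Nat.cast_mul, mul_div_mul_comm])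
    (fun hp ↦ (hloc hp).1) N).2
  rwa [prod_congr rfl fun p hp ↦ (hloc (Nat.prime_of_mem_primesBelow hp)).2] at h

lemma sum_range_divisorSum_div_le {χ : DirichletCharacter ℝ q} (hχ2 : χ ^ 2 = 1) (N : ℕ) :
    ∑ n ∈ range N, χ.divisorSum n / n ≤
      ∏ p ∈ N.primesBelow, ((1 - (p : ℝ)⁻¹)⁻¹ * (1 - χ (p : ZMod q) / p)⁻¹) := by
  have h := (hasSum_subtype_iff_indicator (f := fun n : ℕ ↦ χ.divisorSum n / n)).mp
    (χ.hasSum_smoothNumbers_divisorSum_div N)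
  have hnn (n : ℕ) : 0 ≤ χ.divisorSum n / n := div_nonneg (divisorSum_nonneg hχ2 n) n.cast_nonneg
  refine le_of_eq_of_le (sum_congr rfl fun n hn ↦ ?_)
    (sum_le_hasSum (range N) (fun n _ ↦ Set.indicator_nonneg (fun n _ ↦ hnn n) n) h)
  rcases eq_or_ne n 0 with rfl | hn0
  · simp [divisorSum_zero, Set.indicator]
  · rw [Set.indicator_of_mem]
    exact Nat.mem_smoothNumbers_of_lt (Nat.pos_of_ne_zero hn0) (mem_range.mp hn)

lemma tsum_divisorSum_div_mul_exp_le {χ : DirichletCharacter ℝ q} (hχ2 : χ ^ 2 = 1) {X : ℝ}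
    (hX : 0 < X) {N : ℕ} (hN : X ^ 2 ≤ N) :
    ∑' n : ℕ, χ.divisorSum n / n * Real.exp (-1 / X) ^ n ≤
      ∑ n ∈ range N, χ.divisorSum n / n + 24 * ∑' n : ℕ, ((n : ℝ) ^ 2)⁻¹ := by
  have hsumm : Summable fun n : ℕ ↦ ((n : ℝ) ^ 2)⁻¹ := Real.summable_nat_pow_inv.mpr one_lt_two
  have hexp1 : Real.exp (-1 / X) < 1 :=
    Real.exp_lt_one_iff.mpr (div_neg_of_neg_of_pos (by norm_num) hX)
  have hnn (n : ℕ) : 0 ≤ χ.divisorSum n / n := div_nonneg (divisorSum_nonneg hχ2 n) n.cast_nonneg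
  have hfin : HasSum (fun n ↦ if n ∈ range N then χ.divisorSum n / n else 0)
      (∑ n ∈ range N, χ.divisorSum n / n) := by
    rw [← sum_congr rfl fun n (hn : n ∈ range N) ↦ if_pos hn]
    exact hasSum_sum_of_ne_finset_zero fun n hn ↦ if_neg hn
  refine hasSum_le (fun n ↦ ?_)
    (χ.summable_divisorSum_div_mul_pow (Real.exp_nonneg _) hexp1).hasSum
    (hfin.add (hsumm.hasSum.mul_left 24))
  have hsq : 0 ≤ 24 * ((n : ℝ) ^ 2)⁻¹ := by positivity
  split_ifs with hn
  · have := mul_le_of_le_one_right (hnn n) (pow_le_one₀ (Real.exp_nonneg _) hexp1.le (n := n))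
    linarith
  · have hNn : (N : ℝ) ≤ n := by exact_mod_cast not_lt.mp fun h ↦ hn (mem_range.mpr h)
    have hn0 : (0 : ℝ) < n := (pow_pos hX 2).trans_le (hN.trans hNn)
    have hf : χ.divisorSum n / n ≤ 1 :=
      div_le_one_of_le₀ ((le_abs_self _).trans (χ.abs_divisorSum_le n)) hn0.le
    have hpow : Real.exp (-1 / X) ^ n = (Real.exp (n / X))⁻¹ := by
      rw [← Real.exp_nat_mul, ← Real.exp_neg]
      congr 1
      ring
    have hfac : (n : ℝ) ^ 2 / 24 ≤ Real.exp (n / X) := by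
      refine le_trans ?_ (Real.pow_div_factorial_le_exp _ (by positivity) 4)
      have : (n : ℝ) ^ 2 * X ^ 4 ≤ (n : ℝ) ^ 4 := by
        have := pow_le_pow_left₀ (by positivity) (hN.trans hNn) 2
        nlinarith [sq_nonneg (n : ℝ)]
      rw [div_pow, div_div, div_le_div_iff₀ (by norm_num) (by positivity)]
      norm_num [Nat.factorial]
      linarith
    rw [zero_add]
    calc χ.divisorSum n / n * Real.exp (-1 / X) ^ n ≤ 1 * Real.exp (-1 / X) ^ n :=
          mul_le_mul_of_nonneg_right hf (by positivity)
      _ = (Real.exp (n / X))⁻¹ := by rw [one_mul, hpow]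
      _ ≤ ((n : ℝ) ^ 2 / 24)⁻¹ := inv_anti₀ (by positivity) hfac
      _ = _ := by rw [inv_div, div_eq_mul_inv]

/-- With `P` the Euler product over `p < N` of `ζ(s) L(s, χ)` at `s = 1`, the value `K L(1, χ)` is
at most an absolute constant times `P`, as soon as `N ≥ (2 ^ K q) ^ 2`. -/
lemma mul_realLFunction_one_le_prod [NeZero q] {χ : DirichletCharacter ℝ q} (hχ2 : χ ^ 2 = 1)
    (hχ : χ ≠ 1) {K N : ℕ} (hN : ((q : ℝ) * 2 ^ K) ^ 2 ≤ N) (hN2 : 2 ≤ N) :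
    K * χ.realLFunction 1 ≤ (4 + 48 * ∑' n : ℕ, ((n : ℝ) ^ 2)⁻¹) *
      ∏ p ∈ N.primesBelow, ((1 - (p : ℝ)⁻¹)⁻¹ * (1 - χ (p : ZMod q) / p)⁻¹) := by
  have hq : (0 : ℝ) < q := Nat.cast_pos.mpr (NeZero.pos q)
  have h1 := mul_realLFunction_one_le hχ2 hχ K
  have h2 := tsum_divisorSum_div_mul_exp_le hχ2 (X := q * 2 ^ K) (by positivity) hN
  have h3 := sum_range_divisorSum_div_le hχ2 N
  have hnn (n : ℕ) : 0 ≤ χ.divisorSum n / n := div_nonneg (divisorSum_nonneg hχ2 n) n.cast_nonneg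
  have h4 : (1 : ℝ) ≤ ∑ n ∈ range N, χ.divisorSum n / n := by
    have := single_le_sum (fun n _ ↦ hnn n) (mem_range.mpr (by omega : 1 < N))
    simpa [divisorSum_one] using this
  have hc : 0 ≤ ∑' n : ℕ, ((n : ℝ) ^ 2)⁻¹ := tsum_nonneg fun n ↦ by positivity
  set P := ∏ p ∈ N.primesBelow, ((1 - (p : ℝ)⁻¹)⁻¹ * (1 - χ (p : ZMod q) / p)⁻¹)
  nlinarith

end DirichletCharacter

lemma sq_mul_two_pow_floor_le {u : ℝ} (hu : 48 ≤ u) {q : ℝ} (hq0 : 0 ≤ q) (hq : q ≤ u) :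
    (q * 2 ^ ⌊u / 4⌋₊) ^ 2 ≤ Real.exp u := by
  have h2 : (2 : ℝ) ≤ Real.exp 1 := by linarith [Real.add_one_le_exp (1 : ℝ)]
  have hK : (2 : ℝ) ^ ⌊u / 4⌋₊ ≤ Real.exp (u / 4) := by
    calc (2 : ℝ) ^ ⌊u / 4⌋₊ ≤ Real.exp 1 ^ ⌊u / 4⌋₊ := pow_le_pow_left₀ (by norm_num) h2 _
      _ = Real.exp ⌊u / 4⌋₊ := Real.exp_one_pow _
      _ ≤ Real.exp (u / 4) := Real.exp_le_exp.mpr (Nat.floor_le (by linarith))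
  have hu2 : u ^ 2 ≤ Real.exp (u / 2) := by
    refine le_trans ?_ (Real.pow_div_factorial_le_exp _ (by linarith) 3)
    norm_num [Nat.factorial]
    nlinarith [sq_nonneg u]
  calc (q * 2 ^ ⌊u / 4⌋₊) ^ 2 ≤ (u * Real.exp (u / 4)) ^ 2 := by gcongr
    _ = u ^ 2 * Real.exp (u / 2) := by
        rw [mul_pow, ← Real.exp_nat_mul]
        congr 2
        push_cast
        ring
    _ ≤ Real.exp (u / 2) * Real.exp (u / 2) := by gcongr
    _ = Real.exp u := by rw [← Real.exp_add]; congr 1; ring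

/-- For `x` large and `χ` a primitive quadratic Dirichlet character of modulus `q ≤ log x`,
the truncated Euler product `∏_{p ≤ x}(1 − χ(p)/p)` times `L(1,χ)` is bounded by an absolute
constant. (`L(1,χ)` is real for a quadratic character; it is extracted here as the real part of
the analytically continued Dirichlet `L`-function of the complexification of `χ` at `s = 1`.) -/
theorem stmt_9 :
    ∃ C x₀ : ℝ, ∀ x : ℝ, x₀ ≤ x →
      ∀ (q : ℕ) [NeZero q] (χ : DirichletCharacter ℝ q),
        χ ^ 2 = 1 → χ ≠ 1 → χ.IsPrimitive → (q : ℝ) ≤ Real.log x →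
        (∏ᶠ p ∈ {p : ℕ | p.Prime ∧ (p : ℝ) ≤ x}, (1 - χ (p : ZMod q) / (p : ℝ))) *
          (DirichletCharacter.LFunction (χ.ringHomComp (algebraMap ℝ ℂ)) 1).re ≤ C := by
  have hc : 0 ≤ ∑' n : ℕ, ((n : ℝ) ^ 2)⁻¹ := tsum_nonneg fun n ↦ by positivity
  set c := ∑' n : ℕ, ((n : ℝ) ^ 2)⁻¹
  refine ⟨16 * Real.exp 4 * (4 + 48 * c), Real.exp 48, fun x hx q _ χ hχ2 hχ _ hq ↦ ?_⟩
  have hx0 : 0 < x := (Real.exp_pos _).trans_le hx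
  have hu : 48 ≤ Real.log x := (Real.le_log_iff_exp_le hx0).mpr hx
  have hx4 : 4 ≤ x := by linarith [Real.add_one_le_exp (48 : ℝ)]
  set N := ⌊x⌋₊
  have hN4 : 4 ≤ N := Nat.le_floor (by exact_mod_cast hx4)
  have hset : {p : ℕ | p.Prime ∧ (p : ℝ) ≤ x} = ((N + 1).primesBelow : Set ℕ) := by
    ext p
    simp [Nat.mem_primesBelow, N, Nat.le_floor_iff hx0.le, and_comm]
  rw [hset, finprod_mem_coe_finset]
  change _ * χ.realLFunction 1 ≤ _
  set D := ∏ p ∈ (N + 1).primesBelow, (1 - χ (p : ZMod q) / (p : ℝ)) with hD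
  have hDpos : 0 < D := prod_pos fun p hp ↦ by
    have hp1 : (1 : ℝ) < p := by exact_mod_cast (Nat.prime_of_mem_primesBelow hp).one_lt
    rw [sub_pos, div_lt_one (by linarith)]
    exact ((le_abs_self _).trans (χ.norm_le_one _)).trans_lt hp1
  rcases le_total (χ.realLFunction 1) 0 with hL | hL
  · exact (mul_nonpos_of_nonneg_of_nonpos hDpos.le hL).trans (by positivity)
  have hxN : x ≤ (N + 1 : ℕ) := by push_cast; exact (Nat.lt_floor_add_one x).le
  have hXN := sq_mul_two_pow_floor_le hu (Nat.cast_nonneg q) hq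
  rw [Real.exp_log hx0] at hXN
  have hmain := DirichletCharacter.mul_realLFunction_one_le_prod hχ2 hχ (hXN.trans hxN) (by omega)
  have hlogN : Real.log N ≤ Real.log x :=
    Real.log_le_log (by exact_mod_cast (by omega : 0 < N)) (Nat.floor_le hx0.le)
  have hA := prod_primesBelow_one_sub_inv_inv_le hN4
  have hK : Real.log x / 8 ≤ ⌊Real.log x / 4⌋₊ := by
    linarith [Nat.lt_floor_add_one (Real.log x / 4)]
  have hA2 : ∏ p ∈ (N + 1).primesBelow, (1 - (p : ℝ)⁻¹)⁻¹ ≤ Real.exp 4 * (2 * Real.log x) :=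
    hA.trans (mul_le_mul_of_nonneg_left (by linarith) (Real.exp_nonneg _))
  rw [prod_mul_distrib, prod_inv_distrib (f := fun p : ℕ ↦ 1 - χ (p : ZMod q) / (p : ℝ)), ← hD]
    at hmain
  have hfinal : Real.log x / 8 * χ.realLFunction 1 ≤
      (4 + 48 * c) * (Real.exp 4 * (2 * Real.log x) * D⁻¹) := by
    refine (mul_le_mul_of_nonneg_right hK hL).trans (hmain.trans ?_)
    gcongr
  have hmul := mul_le_mul_of_nonneg_right hfinal hDpos.le
  refine le_of_mul_le_mul_left ?_ (by linarith : 0 < Real.log x / 8)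
  calc Real.log x / 8 * (D * χ.realLFunction 1) = Real.log x / 8 * χ.realLFunction 1 * D := by ring
    _ ≤ _ := hmul
    _ = _ := by field_simp; ring
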